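/- arXiv:1511.09078 — 2 statements merged into one kernel-verified Lean document; each statement's English description precedes it below -/
import Mathlib

section
/- Let y ∈ ℝ^p be a nonnegative vector, let d₁,…,d_p be positive numbers with d₁y₁ ≥ d₂y₂ ≥ … ≥ d_p y_p, let D = diag(d₁,…,d_p), let λ₁ ≥ … ≥ λ_p ≥ 0, and let b* be the unique minimizer of f(b) = ½‖y − Db‖₂² + J_λ(b) over ℝ^p. If b* has exactly r ≥ 1 nonzero entries, then for every j with 1 ≤ j ≤ r one has Σ_{i=j}^{r} (d_i y_i − λ_i) > 0, and for every j with r + 1 ≤ j ≤ p one has Σ_{i=r+1}^{j} (d_i y_i − λ_i) ≤ 0. -/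
/-- The nonincreasing rearrangement of the absolute values of the coordinates of `b`. -/
noncomputable def sortedAbs {p : ℕ} (b : Fin p → ℝ) : Fin p → ℝ :=
  fun i => |b (Tuple.sort (fun j => |b j|) (Fin.rev i))|

/-- The sorted ℓ₁ norm `J_λ(b) = Σ_i λ_i |b|_{(i)}`. -/
noncomputable def Jlam {p : ℕ} (lam b : Fin p → ℝ) : ℝ :=
  ∑ i, lam i * sortedAbs b i

/-- The SLOPE objective with diagonal design matrix `D = diag(d₁,…,d_p)`:
`f(b) = ½ ‖y − D b‖₂² + J_λ(b)`. -/
noncomputable def slopeObj {p : ℕ} (d y lam : Fin p → ℝ) (b : Fin p → ℝ) : ℝ :=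
  (1 / 2) * ∑ i, (y i - d i * b i) ^ 2 + Jlam lam b

/-- The permutation listing the coordinates of `b` in nonincreasing order of absolute value. -/
noncomputable def absOrder {p : ℕ} (b : Fin p → ℝ) : Equiv.Perm (Fin p) :=
  Fin.revPerm.trans (Tuple.sort fun j => |b j|)

theorem absOrder_antitone {p : ℕ} (b : Fin p → ℝ) :
    Antitone fun i => |b (absOrder b i)| := fun _ _ h =>
  Tuple.monotone_sort (fun j => |b j|) (Fin.rev_le_rev.mpr h)

theorem Jlam_eq_sum_absOrder {p : ℕ} (lam b : Fin p → ℝ) :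
    Jlam lam b = ∑ i, lam i * |b (absOrder b i)| := rfl

theorem Jlam_eq_sum_symm {p : ℕ} (lam b : Fin p → ℝ) :
    Jlam lam b = ∑ i, lam ((absOrder b).symm i) * |b i| := by
  rw [Jlam_eq_sum_absOrder, ← Equiv.sum_comp (absOrder b) fun i => _ * |b i|]
  simp

theorem absOrder_symm_lt {p : ℕ} (b : Fin p → ℝ) {i k : Fin p} (h : |b k| < |b i|) :
    (absOrder b).symm i < (absOrder b).symm k := by
  by_contra! hc
  have := absOrder_antitone b hc
  simp only [Equiv.apply_symm_apply] at this
  linarith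

theorem sum_perm_le_Jlam {p : ℕ} {lam : Fin p → ℝ} (hlam : Antitone lam) (b : Fin p → ℝ)
    (π : Equiv.Perm (Fin p)) : ∑ i, lam (π i) * |b i| ≤ Jlam lam b := by
  rw [Jlam_eq_sum_absOrder, ← Equiv.sum_comp (absOrder b) fun i => _ * |b i|]
  have hv : Monovary lam fun i => |b (absOrder b i)| := hlam.monovary (absOrder_antitone b)
  exact hv.sum_comp_perm_mul_le_sum_mul (σ := (absOrder b).trans π)

/-- At a minimizer, moving to `b'` does not decrease the objective in which the sorted norm is
linearized along a permutation sorting `b'`. -/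
theorem exists_perm_of_isMin {p : ℕ} {d y lam b : Fin p → ℝ} (hlam : Antitone lam)
    (hb : ∀ b', slopeObj d y lam b ≤ slopeObj d y lam b') (b' : Fin p → ℝ) :
    ∃ π : Equiv.Perm (Fin p), (∀ i k, |b' k| < |b' i| → π i < π k) ∧
      0 ≤ ∑ i, (((y i - d i * b' i) ^ 2 - (y i - d i * b i) ^ 2) / 2
        + lam (π i) * (|b' i| - |b i|)) := by
  refine ⟨(absOrder b').symm, fun i k => absOrder_symm_lt b', ?_⟩
  have h₁ := hb b'
  have h₂ := sum_perm_le_Jlam hlam b (absOrder b').symm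
  simp only [slopeObj, Jlam_eq_sum_symm lam b'] at h₁
  simp only [mul_sub, sub_div, Finset.sum_add_distrib, Finset.sum_sub_distrib, ← Finset.sum_div]
  linarith

theorem isMin_nonneg {p : ℕ} {d y lam b : Fin p → ℝ} (hd : ∀ i, 0 < d i)
    (hlam : Antitone lam) (hlam_nonneg : ∀ i, 0 ≤ lam i) (hy : ∀ i, 0 ≤ y i)
    (hb : ∀ b', slopeObj d y lam b ≤ slopeObj d y lam b') (i : Fin p) : 0 ≤ b i := by
  by_contra! hi
  obtain ⟨π, -, h⟩ := exists_perm_of_isMin hlam hb (Function.update b i 0)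
  rw [Finset.sum_eq_single i (fun k _ hk => by simp [hk]) (by simp)] at h
  simp only [Function.update_self, abs_zero] at h
  have h₁ := mul_nonneg (hlam_nonneg (π i)) (abs_nonneg (b i))
  have h₂ : 0 < (d i * b i) ^ 2 := sq_pos_of_neg (mul_neg_of_pos_of_neg (hd i) hi)
  have h₃ := mul_nonneg (mul_nonneg (hd i).le (hy i)) (neg_nonneg.mpr hi.le)
  nlinarith

open Filter Topology in
/-- First-order optimality along a direction `v` pointing into the nonnegative orthant: the
directional derivative of the sorted norm is computed by a permutation sorting `b`, with ties
broken by `v`. -/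
theorem exists_perm_directional {p : ℕ} {d y lam b : Fin p → ℝ} (hlam : Antitone lam)
    (hb : ∀ b', slopeObj d y lam b ≤ slopeObj d y lam b') (hb_nonneg : ∀ i, 0 ≤ b i)
    (v : Fin p → ℝ) (hv : ∀ i, b i = 0 → 0 ≤ v i) :
    ∃ π : Equiv.Perm (Fin p), (∀ i k, b k < b i → π i < π k) ∧
      0 ≤ ∑ i, v i * (lam (π i) - d i * y i + d i ^ 2 * b i) := by
  by_contra! hc
  have hpos : ∀ᶠ t : ℝ in 𝓝[>] 0, 0 < t := eventually_mem_nhdsWithin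
  have hlin : ∀ i, Tendsto (fun t : ℝ => b i + t * v i) (𝓝[>] 0) (𝓝 (b i)) := fun i => by
    have : ContinuousAt (fun t : ℝ => b i + t * v i) 0 := by fun_prop
    simpa using this.tendsto.mono_left nhdsWithin_le_nhds
  have hnn : ∀ᶠ t : ℝ in 𝓝[>] 0, ∀ i, 0 ≤ b i + t * v i := by
    refine eventually_all.mpr fun i => ?_
    rcases (hb_nonneg i).eq_or_lt with h | h
    · filter_upwards [hpos] with t ht
      have := mul_nonneg ht.le (hv i h.symm)
      linarith
    · filter_upwards [(hlin i).eventually_const_lt h] with t ht using ht.le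
  have hord : ∀ᶠ t : ℝ in 𝓝[>] 0, ∀ i k, b k < b i → b k + t * v k < b i + t * v i := by
    refine eventually_all.mpr fun i => eventually_all.mpr fun k => ?_
    by_cases h : b k < b i
    · filter_upwards [(hlin k).eventually_lt (hlin i) h] with t ht _ using ht
    · exact Eventually.of_forall fun t h' => absurd h' h
  have hsum : ∀ᶠ t : ℝ in 𝓝[>] 0, ∀ π : Equiv.Perm (Fin p), (∀ i k, b k < b i → π i < π k) →
      ∑ i, v i * (lam (π i) - d i * y i + d i ^ 2 * b i) + t * ∑ i, (d i * v i) ^ 2 / 2 < 0 := by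
    refine eventually_all.mpr fun π => ?_
    by_cases h : ∀ i k, b k < b i → π i < π k
    · have hcont : ContinuousAt (fun t : ℝ =>
          ∑ i, v i * (lam (π i) - d i * y i + d i ^ 2 * b i)
            + t * ∑ i, (d i * v i) ^ 2 / 2) 0 := by fun_prop
      have ht := hcont.tendsto.mono_left (nhdsWithin_le_nhds (s := Set.Ioi 0))
      filter_upwards [ht.eventually_lt_const (by simpa using hc π h)] with t ht _ using ht
    · exact Eventually.of_forall fun t h' => absurd h' h
  obtain ⟨t, ht, hnn, hord, hsum⟩ := (hpos.and (hnn.and (hord.and hsum))).exists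
  obtain ⟨π, hπ, h⟩ := exists_perm_of_isMin hlam hb fun i => b i + t * v i
  simp only [abs_of_nonneg (hnn _), abs_of_nonneg (hb_nonneg _)] at hπ h
  have hneg := mul_neg_of_pos_of_neg ht (hsum π fun i k hik => hπ i k (hord i k hik))
  refine hneg.not_ge (h.trans_eq ?_)
  rw [Finset.mul_sum, ← Finset.sum_add_distrib, Finset.mul_sum]
  exact Finset.sum_congr rfl fun i _ => by ring

/-- A permutation placing `S` before its complement maps `S` onto the first `#S` positions. -/
theorem mem_iff_perm_lt_card {p : ℕ} (S : Finset (Fin p)) (π : Equiv.Perm (Fin p))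
    (h : ∀ i ∈ S, ∀ k ∉ S, π i < π k) (i : Fin p) : i ∈ S ↔ (π i : ℕ) < S.card := by
  constructor
  · intro hi
    have hsub : Sᶜ.map π.toEmbedding ⊆ Finset.Ioi (π i) := fun x hx => by
      obtain ⟨k, hk, rfl⟩ := Finset.mem_map.mp hx
      exact Finset.mem_Ioi.mpr (h i hi k (Finset.mem_compl.mp hk))
    have hle := Finset.card_le_card hsub
    rw [Finset.card_map, Finset.card_compl, Fintype.card_fin, Fin.card_Ioi] at hle
    have := (π i).isLt
    omega
  · intro hi
    by_contra hk
    have hsub : S.map π.toEmbedding ⊆ Finset.Iio (π i) := fun x hx => by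
      obtain ⟨k, hk', rfl⟩ := Finset.mem_map.mp hx
      exact Finset.mem_Iio.mpr (h k hk' i hk)
    have hle := Finset.card_le_card hsub
    rw [Finset.card_map, Fin.card_Iio] at hle
    omega

theorem sum_le_sum_of_card_eq {ι : Type*} [DecidableEq ι] {s t : Finset ι} {f : ι → ℝ}
    (hcard : s.card = t.card) (h : ∀ i ∈ s \ t, ∀ k ∈ t \ s, f i ≤ f k) :
    ∑ i ∈ s, f i ≤ ∑ i ∈ t, f i := by
  have hc : (s \ t).card = (t \ s).card := Finset.card_sdiff_comm hcard
  rw [← Finset.sum_sdiff_le_sum_sdiff]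
  rcases (t \ s).eq_empty_or_nonempty with he | hne
  · have : s \ t = ∅ := by simpa [he] using hc
    simp [he, this]
  · obtain ⟨m, hm, hmin⟩ := Finset.exists_min_image (t \ s) f hne
    calc ∑ i ∈ s \ t, f i ≤ (s \ t).card • f m :=
          Finset.sum_le_card_nsmul _ _ _ fun i hi => h i hi m hm
      _ = (t \ s).card • f m := by rw [hc]
      _ ≤ ∑ i ∈ t \ s, f i := Finset.card_nsmul_le_sum _ _ _ hmin

open Finset in
/-- Lemma 1 of the appendix: if `y ⪰ 0`, `d₁y₁ ≥ … ≥ d_p y_p`, and the minimizer `b*` of the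
diagonal SLOPE objective has exactly `r ≥ 1` nonzero entries, then
`Σ_{i=j}^r (d_i y_i − λ_i) > 0` for every `1 ≤ j ≤ r` and
`Σ_{i=r+1}^j (d_i y_i − λ_i) ≤ 0` for every `r+1 ≤ j ≤ p` (1-indexed sums). -/
theorem slope_partial_sums {p : ℕ} (d y lam : Fin p → ℝ)
    (hd : ∀ i, 0 < d i)
    (hlam_anti : ∀ i j : Fin p, i ≤ j → lam j ≤ lam i)
    (hlam_nonneg : ∀ i, 0 ≤ lam i)
    (hy : ∀ i, 0 ≤ y i)
    (hord : ∀ i j : Fin p, i ≤ j → d j * y j ≤ d i * y i)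
    (bstar : Fin p → ℝ)
    (hbstar : ∀ b, slopeObj d y lam bstar ≤ slopeObj d y lam b)
    (r : ℕ) (hr : 1 ≤ r)
    (hcard : {i : Fin p | bstar i ≠ 0}.ncard = r) :
    (∀ j : ℕ, 1 ≤ j → j ≤ r →
      0 < ∑ i ∈ univ.filter (fun i : Fin p => j ≤ (i : ℕ) + 1 ∧ (i : ℕ) + 1 ≤ r),
        (d i * y i - lam i)) ∧
    (∀ j : ℕ, r + 1 ≤ j → j ≤ p →
      ∑ i ∈ univ.filter (fun i : Fin p => r + 1 ≤ (i : ℕ) + 1 ∧ (i : ℕ) + 1 ≤ j),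
        (d i * y i - lam i) ≤ 0) := by
  have hlam : Antitone lam := hlam_anti
  have hnn := isMin_nonneg hd hlam hlam_nonneg hy hbstar
  set S : Finset (Fin p) := univ.filter fun i => bstar i ≠ 0 with hS
  have hSr : S.card = r := by
    rw [← hcard, ← Set.ncard_coe_finset]
    simp [hS]
  have hsupp : ∀ i, i ∈ S → 0 < bstar i := fun i hi =>
    (hnn i).lt_of_ne' (by simpa [hS] using hi)
  have hzero : ∀ i, i ∉ S → bstar i = 0 := fun i hi => by simpa [hS] using hi
  have hsep : ∀ i ∈ S, ∀ k ∉ S, i < k := by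
    intro i hi k hk
    have hik : i ≠ k := fun h => hk (h ▸ hi)
    obtain ⟨π, hπ, h⟩ := exists_perm_directional hlam hbstar hnn
      (Pi.single k 1 - Pi.single i 1) fun l hl => by
        have hli : l ≠ i := fun h => (hsupp i hi).ne' (h ▸ hl)
        simp only [Pi.sub_apply, Pi.single_eq_of_ne hli, sub_zero, Pi.single_apply]
        positivity
    simp only [Pi.sub_apply, sub_mul, sum_sub_distrib, Pi.single_apply, ite_mul, one_mul,
      zero_mul, sum_ite_eq', mem_univ, if_true, hzero k hk] at h
    have h₁ := hlam (hπ i k (by rw [hzero k hk]; exact hsupp i hi)).le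
    have h₂ := mul_pos (pow_pos (hd i) 2) (hsupp i hi)
    by_contra! hki
    have h₃ := hord k i hki
    linarith
  have hmem : ∀ i, i ∈ S ↔ (i : ℕ) < r := fun i =>
    hSr ▸ mem_iff_perm_lt_card S (Equiv.refl _) hsep i
  have hπmem : ∀ π : Equiv.Perm (Fin p), (∀ i k, bstar k < bstar i → π i < π k) →
      ∀ i : Fin p, (i : ℕ) < r ↔ (π i : ℕ) < r := fun π hπ i => by
    rw [← hmem, ← hSr]
    exact mem_iff_perm_lt_card S π
      (fun i hi k hk => hπ i k (by rw [hzero k hk]; exact hsupp i hi)) i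
  constructor
  · intro j hj hjr
    set T : Finset (Fin p) := univ.filter fun i => j ≤ (i : ℕ) + 1 ∧ (i : ℕ) + 1 ≤ r with hT
    have hTS : ∀ i ∈ T, 0 < bstar i := fun i hi =>
      hsupp i ((hmem i).mpr (by simp [hT] at hi; omega))
    have hrp : r ≤ p := by simpa [hSr] using card_le_univ S
    have hTne : T.Nonempty := ⟨⟨r - 1, by omega⟩, by simp [hT]; omega⟩
    obtain ⟨π, hπ, h⟩ := exists_perm_directional hlam hbstar hnn
      (fun i => if i ∈ T then -1 else 0) fun i hi => by
        rw [if_neg fun hiT => (hTS i hiT).ne' hi]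
    simp only [ite_mul, zero_mul, sum_ite_mem, univ_inter, neg_one_mul, sum_neg_distrib,
      sum_add_distrib, sum_sub_distrib] at h
    have hpos : 0 < ∑ i ∈ T, d i ^ 2 * bstar i :=
      sum_pos (fun i hi => mul_pos (pow_pos (hd i) 2) (hTS i hi)) hTne
    have hle : ∑ i ∈ T, lam i ≤ ∑ i ∈ T.map π.toEmbedding, lam i := by
      refine sum_le_sum_of_card_eq (card_map _).symm fun i hi k hk => hlam ?_
      obtain ⟨hk, hkT⟩ := mem_sdiff.mp hk
      obtain ⟨l, hl, rfl⟩ := mem_map.mp hk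
      have := hπmem π hπ l
      simp [hT] at hi hkT hl
      rw [Fin.le_def]
      simp
      omega
    rw [sum_map] at hle
    simp only [Equiv.coe_toEmbedding] at hle
    rw [sum_sub_distrib]
    linarith
  · intro j hj hjp
    set T : Finset (Fin p) := univ.filter fun i => r + 1 ≤ (i : ℕ) + 1 ∧ (i : ℕ) + 1 ≤ j with hT
    have hTS : ∀ i ∈ T, bstar i = 0 := fun i hi =>
      hzero i fun h => by
        have := (hmem i).mp h
        simp [hT] at hi
        omega
    obtain ⟨π, hπ, h⟩ := exists_perm_directional hlam hbstar hnn
      (fun i => if i ∈ T then 1 else 0) fun i _ => by positivity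
    simp only [ite_mul, zero_mul, sum_ite_mem, univ_inter, one_mul,
      sum_add_distrib, sum_sub_distrib] at h
    have hz : ∑ i ∈ T, d i ^ 2 * bstar i = 0 :=
      sum_eq_zero fun i hi => by rw [hTS i hi, mul_zero]
    have hle : ∑ i ∈ T.map π.toEmbedding, lam i ≤ ∑ i ∈ T, lam i := by
      refine sum_le_sum_of_card_eq (card_map _) fun i hi k hk => hlam ?_
      obtain ⟨hi, hiT⟩ := mem_sdiff.mp hi
      obtain ⟨l, hl, rfl⟩ := mem_map.mp hi
      have := hπmem π hπ l
      simp [hT] at hk hiT hl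
      rw [Fin.le_def]
      simp
      omega
    rw [sum_map] at hle
    simp only [Equiv.coe_toEmbedding] at hle
    rw [sum_sub_distrib]
    linarith
end

section
/- Let y ∈ ℝ^p, let d₁,…,d_p be positive numbers with D = diag(d₁,…,d_p), let λ₁ ≥ … ≥ λ_p ≥ 0, and fix j ∈ {1,…,p}. Define ỹ = (y₁,…,y_{j−1},y_{j+1},…,y_p)ᵀ ∈ ℝ^{p−1}, D̃ = diag(d₁,…,d_{j−1},d_{j+1},…,d_p), and λ̃ = (λ₂,…,λ_p)ᵀ. Let b* be the unique minimizer of ½‖y − Db‖₂² + J_λ(b) over ℝ^p with R(b*) its number of nonzero entries, and let b̃* be the unique minimizer of ½‖ỹ − D̃b‖₂² + J_{λ̃}(b) over ℝ^{p−1} with R̃^j its number of nonzero entries. Then for every integer r ≥ 1, the set of y ∈ ℝ^p with d_j|y_j| > λ_r and R(b*) = r is contained in the set of y ∈ ℝ^p with d_j|y_j| > λ_r and R̃^j = r − 1. -/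
open Finset Filter Topology

/-- The extension by zero of a finite sequence of tuning parameters to all of `ℕ`. -/
noncomputable def zeroExtend {p : ℕ} (lam : Fin p → ℝ) (n : ℕ) : ℝ :=
  if h : n < p then lam ⟨n, h⟩ else 0

lemma zeroExtend_val {p : ℕ} (lam : Fin p → ℝ) (i : Fin p) : zeroExtend lam i = lam i := by
  simp [zeroExtend]

lemma zeroExtend_succ {p : ℕ} (lam : Fin (p + 1) → ℝ) (n : ℕ) :
    zeroExtend (lam ∘ Fin.succ) n = zeroExtend lam (n + 1) := by
  simp [zeroExtend]

lemma zeroExtend_antitone {p : ℕ} {lam : Fin p → ℝ} (h : Antitone lam) (h0 : ∀ i, 0 ≤ lam i) :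
    Antitone (zeroExtend lam) := by
  intro m n hmn
  unfold zeroExtend
  split_ifs with hn hm hm
  · exact h hmn
  · omega
  · exact h0 _
  · exact le_rfl

lemma sum_le_sum_range_of_forall_le {L : ℕ → ℝ} (hL : Antitone L) (s : ℕ) (A : Finset ℕ)
    (hA : ∀ a ∈ A, s ≤ a) : ∑ a ∈ A, L a ≤ ∑ k ∈ range #A, L (s + k) := by
  induction A using Finset.induction_on_max with
  | empty => simp
  | insert m A hm ih =>
    have hmA : m ∉ A := fun h => (hm m h).false
    have hcard : #A ≤ m - s := by
      rw [← Nat.card_Ico]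
      exact card_le_card fun a ha => mem_Ico.2 ⟨hA a (mem_insert_of_mem ha), hm a ha⟩
    have hsm := hA m (mem_insert_self _ _)
    rw [sum_insert hmA, card_insert_of_notMem hmA, sum_range_succ, add_comm]
    exact add_le_add (ih fun a ha => hA a (mem_insert_of_mem ha)) (hL (by omega))

lemma sum_range_le_sum_of_forall_lt {L : ℕ → ℝ} (hL : Antitone L) (s : ℕ) (A : Finset ℕ)
    (hA : ∀ a ∈ A, a < s) : ∑ k ∈ range #A, L (s - #A + k) ≤ ∑ a ∈ A, L a := by
  induction A using Finset.induction_on_min with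
  | empty => simp
  | insert m A hm ih =>
    have hmA : m ∉ A := fun h => (hm m h).false
    have hcard : #A ≤ s - (m + 1) := by
      rw [← Nat.card_Ico]
      exact card_le_card fun a ha => mem_Ico.2 ⟨hm a ha, hA a (mem_insert_of_mem ha)⟩
    have hsm := hA m (mem_insert_self _ _)
    rw [sum_insert hmA, card_insert_of_notMem hmA, sum_range_succ', add_comm]
    refine add_le_add (hL (by omega)) (le_trans (le_of_eq ?_)
      (ih fun a ha => hA a (mem_insert_of_mem ha)))
    exact sum_congr rfl fun k _ => congrArg L (by omega)

lemma card_le_symm_val_of_antitone {p : ℕ} {w : Fin p → ℝ} {π : Equiv.Perm (Fin p)}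
    (hw : Antitone (w ∘ π)) {S : Finset (Fin p)} {x : Fin p} (hx : ∀ i ∈ S, w x < w i) :
    #S ≤ (π.symm x : ℕ) := by
  rw [← Fin.card_Iio, ← card_map π.symm.toEmbedding]
  refine card_le_card fun a ha => ?_
  obtain ⟨i, hi, rfl⟩ := mem_map.1 ha
  refine mem_Iio.2 (lt_of_not_ge fun hle => (hx i hi).not_ge ?_)
  simpa using hw hle

lemma symm_val_lt_card_of_antitone {p : ℕ} {w : Fin p → ℝ} {π : Equiv.Perm (Fin p)}
    (hw : Antitone (w ∘ π)) {S : Finset (Fin p)} {x : Fin p} (hx : ∀ i, w x ≤ w i → i ∈ S) :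
    (π.symm x : ℕ) < #S := by
  rw [Nat.lt_iff_add_one_le, ← Fin.card_Iic, ← card_map π.toEmbedding]
  refine card_le_card fun a ha => ?_
  obtain ⟨i, hi, rfl⟩ := mem_map.1 ha
  refine hx _ ?_
  simpa using hw (mem_Iic.1 hi)

/-- The positions taken by the members of `T` under the arrangement `π`. -/
def positions {p : ℕ} (π : Equiv.Perm (Fin p)) (T : Finset (Fin p)) : Finset ℕ :=
  (T.map π.symm.toEmbedding).map Fin.valEmbedding

lemma card_positions {p : ℕ} (π : Equiv.Perm (Fin p)) (T : Finset (Fin p)) :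
    #(positions π T) = #T := by
  simp [positions]

lemma forall_mem_positions {p : ℕ} {π : Equiv.Perm (Fin p)} {T : Finset (Fin p)} {P : ℕ → Prop} :
    (∀ a ∈ positions π T, P a) ↔ ∀ x ∈ T, P (π.symm x) := by
  simp only [positions, forall_mem_map, Equiv.coe_toEmbedding, Fin.valEmbedding_apply]

lemma sum_mul_indicator_comp {p : ℕ} (lam : Fin p → ℝ) (π : Equiv.Perm (Fin p))
    (T : Finset (Fin p)) (c : ℝ) :
    ∑ i, lam i * (if π i ∈ T then c else 0) = c * ∑ n ∈ positions π T, zeroExtend lam n := by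
  simp only [positions, sum_map, Equiv.coe_toEmbedding, Fin.valEmbedding_apply, zeroExtend_val]
  rw [← Equiv.sum_comp π.symm, mul_sum]
  simp [sum_ite_mem, mul_comm]

lemma exists_perm_Jlam_eq {p : ℕ} (lam b : Fin p → ℝ) :
    ∃ π : Equiv.Perm (Fin p), Antitone ((fun i => |b i|) ∘ π) ∧
      Jlam lam b = ∑ i, lam i * |b (π i)| := by
  refine ⟨Fin.revPerm.trans (Tuple.sort fun j => |b j|), fun i k hik => ?_, rfl⟩
  exact Tuple.monotone_sort (fun j => |b j|) (Fin.rev_le_rev.2 hik)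

lemma sum_mul_abs_perm_le_Jlam {p : ℕ} {lam : Fin p → ℝ} (hlam : Antitone lam) (b : Fin p → ℝ)
    (τ : Equiv.Perm (Fin p)) : ∑ i, lam i * |b (τ i)| ≤ Jlam lam b := by
  obtain ⟨π, hπ, h⟩ := exists_perm_Jlam_eq lam b
  have := (hlam.monovary hπ).sum_mul_comp_perm_le_sum_mul (σ := τ.trans π.symm)
  simpa [h] using this

/-- First-order optimality along a direction `c` in which the absolute values of the coordinates
move linearly with slopes `e`. -/
lemma sum_gradient_mul_le_of_isMin {p : ℕ} {d y lam b : Fin p → ℝ} (hlam : Antitone lam)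
    (hb : ∀ b', slopeObj d y lam b ≤ slopeObj d y lam b') (c e : Fin p → ℝ) (M : ℝ)
    (h : ∀ᶠ ε in 𝓝[>] (0 : ℝ), (∀ i, |b i + ε * c i| = |b i| + ε * e i) ∧
      ∀ π : Equiv.Perm (Fin p), Antitone ((fun i => |b i + ε * c i|) ∘ π) →
        ∑ i, lam i * e (π i) ≤ M) :
    ∑ i, d i * (y i - d i * b i) * c i ≤ M := by
  have hlim : Tendsto (fun ε : ℝ => M + ε * (1 / 2 * ∑ i, (d i * c i) ^ 2)) (𝓝[>] 0) (𝓝 M) := by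
    have : Continuous fun ε : ℝ => M + ε * (1 / 2 * ∑ i, (d i * c i) ^ 2) := by fun_prop
    simpa using (this.tendsto 0).mono_left nhdsWithin_le_nhds
  refine ge_of_tendsto hlim ?_
  filter_upwards [h, self_mem_nhdsWithin] with ε hε hpos
  have hpos : 0 < ε := hpos
  obtain ⟨π, hπ, hJ⟩ := exists_perm_Jlam_eq lam fun i => b i + ε * c i
  have hM := hε.2 π hπ
  have hJb := sum_mul_abs_perm_le_Jlam hlam b π
  have hmin := hb fun i => b i + ε * c i
  simp only [hε.1, mul_add, sum_add_distrib] at hJ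
  have he : ∑ i, lam i * (ε * e (π i)) = ε * ∑ i, lam i * e (π i) := by
    rw [mul_sum]
    exact sum_congr rfl fun i _ => by ring
  have hq : ∑ i, (y i - d i * (b i + ε * c i)) ^ 2 = ∑ i, (y i - d i * b i) ^ 2
      - 2 * ε * ∑ i, d i * (y i - d i * b i) * c i + ε ^ 2 * ∑ i, (d i * c i) ^ 2 := by
    rw [mul_sum, mul_sum, ← sum_sub_distrib, ← sum_add_distrib]
    exact sum_congr rfl fun i _ => by ring
  unfold slopeObj at hmin
  rw [hq, hJ, he] at hmin
  have hεM := mul_le_mul_of_nonneg_left hM hpos.le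
  refine le_of_mul_le_mul_left ?_ hpos
  linarith

/-- `S` splits the coordinates into those surviving the thresholding of the magnitudes `z` by the
sequence `L` and those set to zero. -/
def IsSlopeSplit {ι : Type*} (L : ℕ → ℝ) (z : ι → ℝ) (S : Finset ι) : Prop :=
  (∀ T ⊆ S, T.Nonempty → ∑ k ∈ range #T, L (#S - #T + k) < ∑ i ∈ T, z i) ∧
    ∀ T, Disjoint T S → ∑ i ∈ T, z i ≤ ∑ k ∈ range #T, L (#S + k)

lemma IsSlopeSplit.subset_of_card_le {ι : Type*} {L : ℕ → ℝ} (hL : Antitone L) {z : ι → ℝ}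
    {S U : Finset ι} (hS : IsSlopeSplit L z S) (hU : IsSlopeSplit L z U) (h : #S ≤ #U) :
    U ⊆ S := by
  classical
  by_contra hsub
  have h1 := hU.1 (U \ S) sdiff_subset (sdiff_nonempty.2 hsub)
  have h2 := hS.2 (U \ S) sdiff_disjoint
  have hcard : #U - #(U \ S) ≤ #S := by
    have := le_card_sdiff S U
    omega
  have h3 : ∑ k ∈ range #(U \ S), L (#S + k) ≤ ∑ k ∈ range #(U \ S), L (#U - #(U \ S) + k) :=
    sum_le_sum fun k _ => hL (by omega)
  linarith

lemma IsSlopeSplit.unique {ι : Type*} {L : ℕ → ℝ} (hL : Antitone L) {z : ι → ℝ}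
    {S U : Finset ι} (hS : IsSlopeSplit L z S) (hU : IsSlopeSplit L z U) : S = U := by
  rcases le_total #S #U with h | h
  · exact (eq_of_subset_of_card_le (hS.subset_of_card_le hL hU h) h).symm
  · exact eq_of_subset_of_card_le (hU.subset_of_card_le hL hS h) h

lemma IsSlopeSplit.comap_of_map_eq_erase {ι κ : Type*} [DecidableEq ι] {L : ℕ → ℝ} {z : ι → ℝ}
    {S : Finset ι} (hS : IsSlopeSplit L z S) {j : ι} (hj : j ∈ S) (f : κ ↪ ι) (hf : ∀ k, f k ≠ j)
    {S' : Finset κ} (hS' : S'.map f = S.erase j) :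
    IsSlopeSplit (fun n => L (n + 1)) (fun k => z (f k)) S' := by
  have hcard : #S' + 1 = #S := by
    rw [← card_map f, hS', card_erase_add_one hj]
  refine ⟨fun T hT hne => ?_, fun T hT => ?_⟩
  · have hTS : T.map f ⊆ S := (map_subset_map.2 hT).trans (hS' ▸ erase_subset _ _)
    have hle := card_le_card hT
    have := hS.1 (T.map f) hTS (hne.map)
    rw [card_map, sum_map] at this
    refine lt_of_eq_of_lt (sum_congr rfl fun k _ => congrArg L ?_) this
    omega
  · have hTS : Disjoint (T.map f) S := by
      rw [disjoint_left]
      intro a ha haS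
      obtain ⟨k, hk, rfl⟩ := mem_map.1 ha
      have : f k ∈ S'.map f := hS' ▸ mem_erase.2 ⟨hf k, haS⟩
      exact disjoint_left.1 hT hk ((mem_map' f).1 this)
    have := hS.2 (T.map f) hTS
    rw [card_map, sum_map] at this
    refine this.trans_eq (sum_congr rfl fun k _ => congrArg L ?_)
    omega

lemma eventually_lt_abs_of_ne_zero {p : ℕ} (b : Fin p → ℝ) :
    ∀ᶠ ε in 𝓝[>] (0 : ℝ), ∀ i, b i ≠ 0 → ε < |b i| := by
  refine eventually_all.2 fun i => ?_
  by_cases hi : b i = 0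
  · simp [hi]
  · filter_upwards [mem_nhdsWithin_of_mem_nhds (Iio_mem_nhds (abs_pos.2 hi))] with ε hε _
    exact hε

lemma isSlopeSplit_support_of_isMin {p : ℕ} {d y lam b : Fin p → ℝ} (hd : ∀ i, 0 < d i)
    (hlam : Antitone lam) (h0 : ∀ i, 0 ≤ lam i)
    (hb : ∀ b', slopeObj d y lam b ≤ slopeObj d y lam b') :
    IsSlopeSplit (zeroExtend lam) (fun i => d i * |y i|) {i | b i ≠ 0} := by
  have hL := zeroExtend_antitone hlam h0
  set S : Finset (Fin p) := {i | b i ≠ 0} with hS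
  refine ⟨fun T hT hne => ?_, fun T hT => ?_⟩
  · have hTb : ∀ i ∈ T, b i ≠ 0 := fun i hi => by simpa [hS] using hT hi
    have key := sum_gradient_mul_le_of_isMin hlam hb
      (fun i => if i ∈ T then -SignType.sign (b i) else 0) (fun i => if i ∈ T then -1 else 0)
      (-∑ k ∈ range #T, zeroExtend lam (#S - #T + k)) ?_
    · simp only [mul_ite, mul_zero, sum_ite_mem, univ_inter] at key
      have hlt : ∑ i ∈ T, -(d i * (y i - d i * b i) * -SignType.sign (b i)) <
          ∑ i ∈ T, d i * |y i| := by
        refine sum_lt_sum_of_nonempty hne fun i hi => ?_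
        have h1 := mul_pos (hd i) (hd i)
        rcases lt_or_gt_of_ne (hTb i hi) with h | h
        · have := mul_pos_of_neg_of_neg h (neg_neg_of_pos h1)
          have := mul_le_mul_of_nonneg_left (neg_le_abs (y i)) (hd i).le
          simp only [sign_neg h, SignType.coe_neg, SignType.coe_one]
          linarith
        · have := mul_pos h h1
          have := mul_le_mul_of_nonneg_left (le_abs_self (y i)) (hd i).le
          simp only [sign_pos h, SignType.coe_one]
          linarith
      rw [sum_neg_distrib] at hlt
      linarith
    · filter_upwards [eventually_lt_abs_of_ne_zero b, self_mem_nhdsWithin] with ε hε hpos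
      have hpos : 0 < ε := hpos
      have habs : ∀ i, |b i + ε * (if i ∈ T then -SignType.sign (b i) else 0 : ℝ)| =
          |b i| + ε * (if i ∈ T then -1 else 0) := by
        intro i
        split_ifs with hi
        · have := hε i (hTb i hi)
          rcases lt_or_gt_of_ne (hTb i hi) with h | h
          · rw [abs_of_neg h] at this ⊢
            rw [sign_neg h, SignType.coe_neg, SignType.coe_one, abs_of_neg (by linarith)]
            ring
          · rw [abs_of_pos h] at this ⊢
            rw [sign_pos h, SignType.coe_one, abs_of_pos (by linarith)]
        · simp
      refine ⟨habs, fun π hπ => ?_⟩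
      simp only [habs] at hπ
      rw [sum_mul_indicator_comp, neg_one_mul, neg_le_neg_iff, ← card_positions π T]
      refine sum_range_le_sum_of_forall_lt hL _ _ (forall_mem_positions.2 fun x hx => ?_)
      refine symm_val_lt_card_of_antitone hπ fun i hi => ?_
      by_contra hiS
      have hbi : b i = 0 := by simpa [hS] using hiS
      have hiT : i ∉ T := fun h => hiS (hT h)
      have := hε x (hTb x hx)
      simp only [hx, hiT, hbi, if_true, if_false, abs_zero] at hi
      linarith
  · have hTb : ∀ i ∈ T, b i = 0 := fun i hi => by
      simpa [hS] using disjoint_left.1 hT hi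
    have hSb : ∀ i ∈ S, b i ≠ 0 ∧ i ∉ T := fun i hi =>
      ⟨by simpa [hS] using hi, disjoint_right.1 hT hi⟩
    have key := sum_gradient_mul_le_of_isMin hlam hb
      (fun i => if i ∈ T then (if 0 ≤ y i then 1 else -1) else 0)
      (fun i => if i ∈ T then 1 else 0)
      (∑ k ∈ range #T, zeroExtend lam (#S + k)) ?_
    · refine le_of_eq_of_le ?_ key
      simp only [mul_ite, mul_zero, sum_ite_mem, univ_inter]
      refine sum_congr rfl fun i hi => ?_
      rw [hTb i hi]
      split_ifs with h
      · rw [abs_of_nonneg h]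
        ring
      · rw [abs_of_neg (not_le.1 h)]
        ring
    · filter_upwards [eventually_lt_abs_of_ne_zero b, self_mem_nhdsWithin] with ε hε hpos
      have hpos : 0 < ε := hpos
      have habs : ∀ i, |b i + ε * (if i ∈ T then (if 0 ≤ y i then 1 else -1) else 0 : ℝ)| =
          |b i| + ε * (if i ∈ T then 1 else 0) := by
        intro i
        split_ifs with hi h
        · simp [hTb i hi, abs_of_pos hpos]
        · simp [hTb i hi, abs_of_pos hpos]
        · simp
      refine ⟨habs, fun π hπ => ?_⟩
      simp only [habs] at hπ
      rw [sum_mul_indicator_comp, one_mul, ← card_positions π T]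
      refine sum_le_sum_range_of_forall_le hL _ _ (forall_mem_positions.2 fun x hx => ?_)
      refine card_le_symm_val_of_antitone hπ fun i hi => ?_
      have := hε i (hSb i hi).1
      simp only [hx, (hSb i hi).2, hTb x hx, if_true, if_false, abs_zero]
      linarith

/-- Lemma 3 of the appendix.  The ambient dimension is `p + 1`; deleting the coordinate
`j : Fin (p+1)` (via `Fin.succAbove`) and the first tuning parameter gives the reduced
problem on `ℝ^p` with data `ỹ = (y_k)_{k ≠ j}`, `D̃ = diag((d_k)_{k ≠ j})`,
`λ̃ = (λ₂,…,λ_{p+1})`.  If `b*` solves the full problem and `b̃*` solves the reduced problem,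
then for every `r ≥ 1` (encoded as `r : Fin (p+1)` representing the 1-indexed value `r+1`):
`d_j |y_j| > λ_r` and `R(b*) = r` imply `d_j |y_j| > λ_r` and `R̃ʲ(b̃*) = r − 1`. -/
theorem slope_reduced_support {p : ℕ} (d y lam : Fin (p + 1) → ℝ)
    (hd : ∀ i, 0 < d i)
    (hlam_anti : ∀ i j : Fin (p + 1), i ≤ j → lam j ≤ lam i)
    (hlam_nonneg : ∀ i, 0 ≤ lam i)
    (j : Fin (p + 1)) (r : Fin (p + 1))
    (bstar : Fin (p + 1) → ℝ)
    (hbstar : ∀ b, slopeObj d y lam bstar ≤ slopeObj d y lam b)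
    (btilde : Fin p → ℝ)
    (hbtilde : ∀ b, slopeObj (fun i => d (j.succAbove i)) (fun i => y (j.succAbove i))
        (fun i => lam i.succ) btilde ≤
      slopeObj (fun i => d (j.succAbove i)) (fun i => y (j.succAbove i))
        (fun i => lam i.succ) b)
    (hthr : lam r < d j * |y j|)
    (hcard : {k : Fin (p + 1) | bstar k ≠ 0}.ncard = (r : ℕ) + 1) :
    lam r < d j * |y j| ∧ {k : Fin p | btilde k ≠ 0}.ncard = (r : ℕ) := by
  refine ⟨hthr, ?_⟩
  have hanti : Antitone lam := fun i k h => hlam_anti i k h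
  have hL := zeroExtend_antitone hanti hlam_nonneg
  have hS := isSlopeSplit_support_of_isMin hd hanti hlam_nonneg hbstar
  have hU := isSlopeSplit_support_of_isMin (fun i => hd (j.succAbove i))
    (hanti.comp_monotone (Fin.strictMono_succ (n := p)).monotone)
    (fun i => hlam_nonneg i.succ) hbtilde
  rw [Set.ncard_eq_toFinset_card', Set.toFinset_ofPred] at hcard ⊢
  set S : Finset (Fin (p + 1)) := {k | bstar k ≠ 0}
  have hj : j ∈ S := by
    by_contra hj
    have h1 := hS.2 {j} (disjoint_singleton_left.2 hj)
    simp only [sum_singleton, card_singleton, sum_range_one, add_zero, hcard] at h1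
    have h2 := hL (Nat.le_succ (r : ℕ))
    rw [zeroExtend_val] at h2
    linarith
  have hmap : (S.preimage j.succAbove Fin.succAbove_right_injective.injOn).map j.succAboveEmb =
      S.erase j := by
    ext i
    simp only [Finset.mem_map, Finset.mem_preimage, Fin.succAboveEmb_apply, mem_erase]
    constructor
    · rintro ⟨k, hk, rfl⟩
      exact ⟨Fin.succAbove_ne j k, hk⟩
    · rintro ⟨hne, hi⟩
      obtain ⟨k, rfl⟩ := Fin.exists_succAbove_eq hne
      exact ⟨k, hi, rfl⟩
  have hS' := hS.comap_of_map_eq_erase hj j.succAboveEmb (Fin.succAbove_ne j) hmap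
  have hsucc : zeroExtend (lam ∘ Fin.succ) = fun n => zeroExtend lam (n + 1) :=
    funext (zeroExtend_succ lam)
  rw [hsucc] at hU
  have heq := hU.unique (fun m n h => hL (Nat.succ_le_succ h)) hS'
  rw [heq, ← card_map j.succAboveEmb, hmap, card_erase_of_mem hj, hcard, Nat.add_sub_cancel]
end
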